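/- (Comparison of the initial discrete bounds with the Lipschitz bounds, lower part) Assume (A0) and (A1) and let the scheme be initialized by U^{α,0}_i = u₀^α(iΔx). Then m⁰ ≥ m⁰₀, and consequently p̲⁰_α ≤ p̲_α and p̄_α ≤ p̄⁰_α for every α = 1,…,N. -/

import Mathlib

open Set Filter

/-- Assumption (A1) for a single Hamiltonian: `H` is `C¹`, coercive
(`H p → +∞` as `|p| → +∞`), non-increasing on `(-∞, p₀]` and non-decreasing on `[p₀, +∞)`. -/
def A1cond (H : ℝ → ℝ) (p₀ : ℝ) : Prop :=
  ContDiff ℝ 1 H ∧ Tendsto H (cocompact ℝ) atTop ∧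
    AntitoneOn H (Iic p₀) ∧ MonotoneOn H (Ici p₀)

/-- The non-increasing envelope `H⁻` of `H` with turning point `p₀`. -/
noncomputable def Hm (H : ℝ → ℝ) (p₀ : ℝ) (p : ℝ) : ℝ :=
  if p ≤ p₀ then H p else H p₀

/-- The non-decreasing envelope `H⁺` of `H` with turning point `p₀`. -/
noncomputable def Hp (H : ℝ → ℝ) (p₀ : ℝ) (p : ℝ) : ℝ :=
  if p ≤ p₀ then H p₀ else H p

/-- One time step of the numerical scheme (NS) on the junction:
`V` (the values at time `n+1`) is computed from `U` (the values at time `n`).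
For `i ≥ 1` on each branch `α` the update uses
`max (H⁺_α(p_{i,-}), H⁻_α(p_{i,+}))`; at the junction point `i = 0` all branches share a
common value and the update uses `max_β H⁻_β(p^β_{0,+})`. -/
def SchemeStep {N : ℕ} (H : Fin N → ℝ → ℝ) (p₀ : Fin N → ℝ) (Δx Δt : ℝ)
    (U V : Fin N → ℕ → ℝ) : Prop :=
  (∀ (α : Fin N) (i : ℕ), 1 ≤ i →
      V α i = U α i - Δt * max (Hp (H α) (p₀ α) ((U α i - U α (i - 1)) / Δx))
        (Hm (H α) (p₀ α) ((U α (i + 1) - U α i) / Δx))) ∧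
  (∀ α β : Fin N, U α 0 = U β 0) ∧
  (∀ α : Fin N, V α 0 = U α 0 - Δt *
      sSup (Set.range fun β : Fin N => Hm (H β) (p₀ β) ((U β 1 - U β 0) / Δx)))

/-- The numerical scheme (NS): `U α n i` is the value on branch `α` at time step `n`
and grid point `i`. -/
def SchemeNS {N : ℕ} (H : Fin N → ℝ → ℝ) (p₀ : Fin N → ℝ) (Δx Δt : ℝ)
    (U : Fin N → ℕ → ℕ → ℝ) : Prop :=
  ∀ n : ℕ, SchemeStep H p₀ Δx Δt (fun α i => U α n i) (fun α i => U α (n + 1) i)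

lemma Hm_eq_comp_min (H : ℝ → ℝ) (p₀ p : ℝ) : Hm H p₀ p = H (min p p₀) := by
  unfold Hm
  split_ifs with h
  · rw [min_eq_left h]
  · rw [min_eq_right (not_le.mp h).le]

lemma Hp_eq_comp_max (H : ℝ → ℝ) (p₀ p : ℝ) : Hp H p₀ p = H (max p p₀) := by
  unfold Hp
  split_ifs with h
  · rw [max_eq_right h]
  · rw [max_eq_left (not_le.mp h).le]

namespace A1cond

variable {H : ℝ → ℝ} {p₀ : ℝ}

lemma continuous (h : A1cond H p₀) : Continuous H := h.1.continuous

lemma apply_turning_point_le (h : A1cond H p₀) (p : ℝ) : H p₀ ≤ H p := by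
  rcases le_total p p₀ with hp | hp
  · exact h.2.2.1 hp self_mem_Iic hp
  · exact h.2.2.2 self_mem_Ici hp hp

lemma Hm_le (h : A1cond H p₀) (p : ℝ) : Hm H p₀ p ≤ H p := by
  unfold Hm
  split_ifs
  · exact le_rfl
  · exact h.apply_turning_point_le p

lemma Hp_le (h : A1cond H p₀) (p : ℝ) : Hp H p₀ p ≤ H p := by
  unfold Hp
  split_ifs
  · exact h.apply_turning_point_le p
  · exact le_rfl

lemma continuous_Hm (h : A1cond H p₀) : Continuous (Hm H p₀) := by
  rw [funext (Hm_eq_comp_min H p₀)]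
  exact h.continuous.comp (continuous_id.min continuous_const)

lemma continuous_Hp (h : A1cond H p₀) : Continuous (Hp H p₀) := by
  rw [funext (Hp_eq_comp_max H p₀)]
  exact h.continuous.comp (continuous_id.max continuous_const)

lemma tendsto_Hm_atBot (h : A1cond H p₀) : Tendsto (Hm H p₀) atBot atTop := by
  refine (h.2.1.mono_left atBot_le_cocompact).congr' ?_
  filter_upwards [eventually_le_atBot p₀] with p hp
  rw [Hm_eq_comp_min, min_eq_left hp]

lemma tendsto_Hp_atTop (h : A1cond H p₀) : Tendsto (Hp H p₀) atTop atTop := by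
  refine (h.2.1.mono_left atTop_le_cocompact).congr' ?_
  filter_upwards [eventually_ge_atTop p₀] with p hp
  rw [Hp_eq_comp_max, max_eq_left hp]

end A1cond

lemma exists_le_eq_of_tendsto_atBot {f : ℝ → ℝ} (hf : Continuous f)
    (hlim : Tendsto f atBot atTop) {p d : ℝ} (hp : f p ≤ d) : ∃ q ≤ p, f q = d := by
  obtain ⟨r, hdr, hrp⟩ := ((hlim.eventually_ge_atTop d).and (eventually_le_atBot p)).exists
  obtain ⟨q, hq, rfl⟩ := intermediate_value_Icc' hrp hf.continuousOn ⟨hp, hdr⟩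
  exact ⟨q, hq.2, rfl⟩

lemma bddBelow_level_of_tendsto_atBot {f : ℝ → ℝ} (hlim : Tendsto f atBot atTop) (d : ℝ) :
    BddBelow {p | f p = d} := by
  obtain ⟨r, hr⟩ := eventually_atBot.mp (hlim.eventually_gt_atTop d)
  refine ⟨r, fun p hp => ?_⟩
  by_contra! hpr
  exact (hr p hpr.le).ne' hp

/-- The smallest solution of `f p = d` decreases as the level `d` increases. -/
lemma sInf_level_le_of_tendsto_atBot {f : ℝ → ℝ} (hf : Continuous f)
    (hlim : Tendsto f atBot atTop) {p c d : ℝ} (hp : f p ≤ c) (hcd : c ≤ d) :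
    sInf {p | f p = d} ≤ sInf {p | f p = c} := by
  obtain ⟨q, -, hq⟩ := exists_le_eq_of_tendsto_atBot hf hlim hp
  refine le_csInf ⟨q, hq⟩ fun x hx => ?_
  obtain ⟨y, hyx, hy⟩ := exists_le_eq_of_tendsto_atBot hf hlim ((le_of_eq hx).trans hcd)
  exact (csInf_le (bddBelow_level_of_tendsto_atBot hlim d) hy).trans hyx

lemma exists_ge_eq_of_tendsto_atTop {f : ℝ → ℝ} (hf : Continuous f)
    (hlim : Tendsto f atTop atTop) {p d : ℝ} (hp : f p ≤ d) : ∃ q, p ≤ q ∧ f q = d := by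
  obtain ⟨r, hdr, hpr⟩ := ((hlim.eventually_ge_atTop d).and (eventually_ge_atTop p)).exists
  obtain ⟨q, hq, rfl⟩ := intermediate_value_Icc hpr hf.continuousOn ⟨hp, hdr⟩
  exact ⟨q, hq.1, rfl⟩

lemma bddAbove_level_of_tendsto_atTop {f : ℝ → ℝ} (hlim : Tendsto f atTop atTop) (d : ℝ) :
    BddAbove {p | f p = d} := by
  obtain ⟨r, hr⟩ := eventually_atTop.mp (hlim.eventually_gt_atTop d)
  refine ⟨r, fun p hp => ?_⟩
  by_contra! hpr
  exact (hr p hpr.le).ne' hp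

/-- The largest solution of `f p = d` increases as the level `d` increases. -/
lemma sSup_level_le_of_tendsto_atTop {f : ℝ → ℝ} (hf : Continuous f)
    (hlim : Tendsto f atTop atTop) {p c d : ℝ} (hp : f p ≤ c) (hcd : c ≤ d) :
    sSup {p | f p = c} ≤ sSup {p | f p = d} := by
  obtain ⟨q, -, hq⟩ := exists_ge_eq_of_tendsto_atTop hf hlim hp
  refine csSup_le ⟨q, hq⟩ fun x hx => ?_
  obtain ⟨y, hxy, hy⟩ := exists_ge_eq_of_tendsto_atTop hf hlim ((le_of_eq hx).trans hcd)
  exact hxy.trans (le_csSup (bddAbove_level_of_tendsto_atTop hlim d) hy)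

lemma bddBelow_neg_image_Icc {ι : Type*} [Finite ι] {H : ι → ℝ → ℝ}
    (hH : ∀ α, Continuous (H α)) (a b : ι → ℝ) :
    BddBelow {v : ℝ | ∃ (α : ι) (p : ℝ), a α ≤ p ∧ p ≤ b α ∧ v = -(H α p)} := by
  have key : BddBelow (⋃ α, (fun p => -(H α p)) '' Icc (a α) (b α)) := by
    rw [← biUnion_univ, finite_univ.bddBelow_biUnion]
    exact fun α _ => (isCompact_Icc.image (hH α).neg).bddBelow
  refine key.mono ?_
  rintro v ⟨α, p, hap, hpb, rfl⟩
  exact mem_iUnion.mpr ⟨α, p, ⟨hap, hpb⟩, rfl⟩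

/-- **Comparison of the initial discrete bounds with the Lipschitz bounds, lower part**
(Step 1 of the proof of Lemma 3.6). Assume (A0) and (A1) and initialize the scheme by
`U^{α,0}_i = u₀^α(iΔx)`. Then `m⁰ ≥ m⁰₀`, and consequently `p̲⁰_α ≤ p̲_α` and
`p̄_α ≤ p̄⁰_α` for every `α`. -/
theorem initial_bounds_lower_part {N : ℕ} (hN : 1 ≤ N)
    (H : Fin N → ℝ → ℝ) (p₀ : Fin N → ℝ)
    (hA1 : ∀ α, A1cond (H α) (p₀ α))
    (u₀ : Fin N → ℝ → ℝ)
    (hcompat : ∀ α β : Fin N, u₀ α 0 = u₀ β 0)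
    (Lm Lp : Fin N → ℝ)
    (hLp : ∀ α, IsLeast
      {L : ℝ | ∀ x a : ℝ, 0 ≤ x → 0 ≤ a → u₀ α (x + a) - u₀ α x ≤ a * L} (Lp α))
    (hLm : ∀ α, IsGreatest
      {L : ℝ | ∀ x a : ℝ, 0 ≤ x → 0 ≤ a → a * L ≤ u₀ α (x + a) - u₀ α x} (Lm α))
    (Δx Δt : ℝ) (hΔx : 0 < Δx) (hΔt : 0 < Δt)
    (U0 U1 : Fin N → ℕ → ℝ)
    (hstep : SchemeStep H p₀ Δx Δt U0 U1)
    (hinit : ∀ (α : Fin N) (i : ℕ), U0 α i = u₀ α (i * Δx))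
    (m0 : ℝ)
    (hm0 : m0 = sInf (Set.range fun q : Fin N × ℕ => (U1 q.1 q.2 - U0 q.1 q.2) / Δt))
    (plow pbar : Fin N → ℝ)
    (hplow : ∀ α, plow α = sInf {p : ℝ | Hm (H α) (p₀ α) p = -m0})
    (hpbar : ∀ α, pbar α = sSup {p : ℝ | Hp (H α) (p₀ α) p = -m0})
    (m00 : ℝ)
    (hm00 : m00 = sInf {v : ℝ | ∃ (α : Fin N) (p : ℝ),
      Lm α ≤ p ∧ p ≤ Lp α ∧ v = -(H α p)})
    (plow0 pbar0 : Fin N → ℝ)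
    (hplow0 : ∀ α, plow0 α = sInf {p : ℝ | Hm (H α) (p₀ α) p = -m00})
    (hpbar0 : ∀ α, pbar0 α = sSup {p : ℝ | Hp (H α) (p₀ α) p = -m00}) :
    m00 ≤ m0 ∧ ∀ α : Fin N, plow0 α ≤ plow α ∧ pbar α ≤ pbar0 α := by
  have : Nonempty (Fin N) := ⟨⟨0, hN⟩⟩
  have hH : ∀ α p, Lm α ≤ p → p ≤ Lp α → H α p ≤ -m00 := by
    intro α p h1 h2
    have := csInf_le (bddBelow_neg_image_Icc (fun α => (hA1 α).continuous) Lm Lp)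
      ⟨α, p, h1, h2, rfl⟩
    linarith
  have hslope : ∀ α (i : ℕ), H α ((U0 α (i + 1) - U0 α i) / Δx) ≤ -m00 := by
    intro α i
    have hx : (0 : ℝ) ≤ i * Δx := by positivity
    have hnext : U0 α (i + 1) = u₀ α (i * Δx + Δx) := by
      rw [hinit]
      push_cast
      ring_nf
    apply hH
    · rw [le_div_iff₀ hΔx, hnext, hinit, mul_comm (Lm α)]
      exact (hLm α).1 _ _ hx hΔx.le
    · rw [div_le_iff₀ hΔx, hnext, hinit, mul_comm (Lp α)]
      exact (hLp α).1 _ _ hx hΔx.le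
  obtain ⟨hinner, -, hjunction⟩ := hstep
  have hquot : ∀ {u v c : ℝ}, v = u - Δt * c → (v - u) / Δt = -c := by
    rintro u v c rfl
    field_simp
    ring
  have hW : m00 ∈ lowerBounds
      (range fun q : Fin N × ℕ => (U1 q.1 q.2 - U0 q.1 q.2) / Δt) := by
    rintro _ ⟨⟨α, i⟩, rfl⟩
    rcases i with _ | i
    · change m00 ≤ (U1 α 0 - U0 α 0) / Δt
      rw [hquot (hjunction α), le_neg]
      refine csSup_le (range_nonempty _) ?_
      rintro _ ⟨β, rfl⟩
      exact ((hA1 β).Hm_le _).trans (hslope β 0)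
    · change m00 ≤ (U1 α (i + 1) - U0 α (i + 1)) / Δt
      rw [hquot (hinner α (i + 1) (by omega)), le_neg]
      exact max_le (((hA1 α).Hp_le _).trans (hslope α i))
        (((hA1 α).Hm_le _).trans (hslope α (i + 1)))
  have hm : m00 ≤ m0 := hm0 ▸ le_csInf (range_nonempty _) hW
  have hmin : ∀ α, H α (p₀ α) ≤ -m0 := by
    intro α
    have h1 : m0 ≤ (U1 α 1 - U0 α 1) / Δt := hm0 ▸ csInf_le ⟨m00, hW⟩ ⟨(α, 1), rfl⟩
    rw [hquot (hinner α 1 le_rfl), le_neg] at h1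
    refine le_trans ?_ ((le_max_left _ _).trans h1)
    rw [Hp_eq_comp_max]
    exact (hA1 α).apply_turning_point_le _
  refine ⟨hm, fun α => ⟨?_, ?_⟩⟩
  · rw [hplow0, hplow]
    exact sInf_level_le_of_tendsto_atBot (hA1 α).continuous_Hm (hA1 α).tendsto_Hm_atBot
      (((hA1 α).Hm_le _).trans (hmin α)) (neg_le_neg hm)
  · rw [hpbar, hpbar0]
    exact sSup_level_le_of_tendsto_atTop (hA1 α).continuous_Hp (hA1 α).tendsto_Hp_atTop
      (((hA1 α).Hp_le _).trans (hmin α)) (neg_le_neg hm)
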